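/- Cubic-quintic normal form for the Salerno model: there exist constants C₁ > 0 and ρ₀ > 0 (depending on ν, γ, N) such that for all 0 < ρ ≤ ρ₀ and all ε ∈ (0,1], the transformed Salerno Hamiltonian K = H ∘ Φ satisfies sup over the ball {(x,y) ∈ ℝ^N×ℝ^N : ‖(x,y)‖ ≤ ρ} of |K(x,y) − Z⁽¹⁾(x,y)| ≤ C₁ · ν² · ρ⁶ · (ρ² + ε), where Z⁽¹⁾(x,y) = Σ_j [ (γ/8)(x_j²+y_j²)² + ε(x_{j+1}x_j + y_{j+1}y_j) + (γν/24)(x_j²+y_j²)³ + (εν/4)(x_j²+y_j²)((x_{j+1}+x_{j−1})x_j + (y_{j+1}+y_{j−1})y_j) ]. -/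

import Mathlib

/-- `σ(s) = √((exp s − 1)/s)` for `s ≠ 0`, `σ(0) = 1`. -/
noncomputable def sigmaFun (s : ℝ) : ℝ :=
  if s = 0 then 1 else Real.sqrt ((Real.exp s - 1) / s)

/-- The Salerno Hamiltonian in Cartesian coordinates on the periodic lattice `ℤ/N`. -/
noncomputable def salernoH (ν γ ε : ℝ) (N : ℕ) [NeZero N] (q p : ZMod N → ℝ) : ℝ :=
  (∑ j : ZMod N, (-(γ / (4 * ν ^ 2)) * Real.log (1 + ν * ((q j) ^ 2 + (p j) ^ 2))
      + γ / (4 * ν) * ((q j) ^ 2 + (p j) ^ 2)))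
  + ε * ∑ j : ZMod N, (q (j + 1) * q j + p (j + 1) * p j)

/-- The componentwise Darboux transformation `Φ`, first component `q_j`. -/
noncomputable def Qmap (ν : ℝ) {N : ℕ} (x y : ZMod N → ℝ) : ZMod N → ℝ :=
  fun j => x j * sigmaFun (ν * ((x j) ^ 2 + (y j) ^ 2))

/-- The componentwise Darboux transformation `Φ`, second component `p_j`. -/
noncomputable def Pmap (ν : ℝ) {N : ℕ} (x y : ZMod N → ℝ) : ZMod N → ℝ :=
  fun j => y j * sigmaFun (ν * ((x j) ^ 2 + (y j) ^ 2))

/-- The cubic-quintic normal form Hamiltonian `Z⁽¹⁾`. -/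
noncomputable def Z1 (ν γ ε : ℝ) (N : ℕ) [NeZero N] (x y : ZMod N → ℝ) : ℝ :=
  ∑ j : ZMod N, (γ / 8 * ((x j) ^ 2 + (y j) ^ 2) ^ 2
    + ε * (x (j + 1) * x j + y (j + 1) * y j)
    + γ * ν / 24 * ((x j) ^ 2 + (y j) ^ 2) ^ 3
    + ε * ν / 4 * ((x j) ^ 2 + (y j) ^ 2) *
        ((x (j + 1) + x (j - 1)) * x j + (y (j + 1) + y (j - 1)) * y j))

theorem abs_exp_sub_cubic_le {s : ℝ} (h0 : 0 ≤ s) (h1 : s ≤ 1) :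
    |Real.exp s - (1 + s + s ^ 2 / 2 + s ^ 3 / 6)| ≤ s ^ 4 := by
  have h := Real.exp_bound (x := s) (by rwa [abs_of_nonneg h0]) (n := 4) (by norm_num)
  simp only [Finset.sum_range_succ, Finset.sum_range_zero, Nat.factorial, abs_of_nonneg h0] at h
  norm_num at h
  have h4 : 0 ≤ s ^ 4 := by positivity
  rw [abs_le] at h ⊢
  constructor <;> linarith [h.1, h.2]

theorem mul_sigmaFun_sq {s : ℝ} (h0 : 0 ≤ s) : s * sigmaFun s ^ 2 = Real.exp s - 1 := by
  unfold sigmaFun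
  split_ifs with hs
  · simp [hs]
  · have h : 0 ≤ (Real.exp s - 1) / s :=
      div_nonneg (by linarith [Real.add_one_le_exp s]) h0
    rw [Real.sq_sqrt h]
    field_simp

theorem sigmaFun_nonneg (s : ℝ) : 0 ≤ sigmaFun s := by
  unfold sigmaFun
  split_ifs
  · exact zero_le_one
  · exact Real.sqrt_nonneg _

theorem sigmaFun_bounds {s : ℝ} (h0 : 0 ≤ s) (h1 : s ≤ 1) :
    1 + s / 4 ≤ sigmaFun s ∧ sigmaFun s ≤ 1 + s / 4 + s ^ 2 := by
  rcases h0.eq_or_lt with rfl | hs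
  · simp [sigmaFun]
  have hq : sigmaFun s ^ 2 = (Real.exp s - 1) / s := by
    rw [eq_div_iff hs.ne', mul_comm, mul_sigmaFun_sq h0]
  have hu := (abs_le.1 (abs_exp_sub_cubic_le h0 h1)).2
  have hl := Real.sum_le_exp_of_nonneg h0 4
  simp only [Finset.sum_range_succ, Finset.sum_range_zero, Nat.factorial] at hl
  norm_num at hl
  have h2 := pow_pos hs 2
  have h3 := pow_pos hs 3
  have h43 : s ^ 4 ≤ s ^ 3 := pow_le_pow_of_le_one h0 h1 (by norm_num)
  have h5 := pow_pos hs 5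
  constructor
  · refine le_of_sq_le_sq ?_ (sigmaFun_nonneg s)
    rw [hq, le_div_iff₀ hs]
    nlinarith
  · refine le_of_sq_le_sq ?_ (by positivity)
    rw [hq, div_le_iff₀ hs]
    nlinarith

theorem abs_sigmaFun_mul_sub_le {s s' t : ℝ} (h0 : 0 ≤ s) (h0' : 0 ≤ s') (hs : s ≤ t)
    (hs' : s' ≤ t) (ht : t ≤ 1) :
    |sigmaFun s * sigmaFun s' - (1 + (s + s') / 4)| ≤ 4 * t ^ 2 := by
  obtain ⟨hl, hu⟩ := sigmaFun_bounds h0 (hs.trans ht)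
  obtain ⟨hl', hu'⟩ := sigmaFun_bounds h0' (hs'.trans ht)
  obtain ⟨d, hd⟩ : ∃ d, sigmaFun s = 1 + s / 4 + d := ⟨sigmaFun s - (1 + s / 4), by ring⟩
  obtain ⟨d', hd'⟩ : ∃ d, sigmaFun s' = 1 + s' / 4 + d := ⟨sigmaFun s' - (1 + s' / 4), by ring⟩
  rw [hd] at hl hu
  rw [hd'] at hl' hu'
  have hd0 : 0 ≤ d := by linarith
  have hd0' : 0 ≤ d' := by linarith
  have ht0 : 0 ≤ t := h0.trans hs
  have hdt : d ≤ t ^ 2 := by nlinarith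
  have hdt' : d' ≤ t ^ 2 := by nlinarith
  have ht2 : t ^ 2 ≤ 1 := pow_le_one₀ ht0 ht
  have hss : s * s' ≤ t ^ 2 := by nlinarith
  have hds : d * s' ≤ t ^ 2 := by nlinarith
  have hds' : d' * s ≤ t ^ 2 := by nlinarith
  have hdd : d * d' ≤ t ^ 2 := by nlinarith
  have e : sigmaFun s * sigmaFun s' - (1 + (s + s') / 4)
      = s * s' / 16 + d + d' + d * s' / 4 + d' * s / 4 + d * d' := by
    rw [hd, hd']; ring
  rw [e, abs_of_nonneg (by positivity)]
  linarith [sq_nonneg t]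

theorem onsite_transformed_eq {ν : ℝ} (hν : 0 < ν) (γ x y : ℝ) :
    -(γ / (4 * ν ^ 2)) * Real.log (1 + ν * ((x * sigmaFun (ν * (x ^ 2 + y ^ 2))) ^ 2
          + (y * sigmaFun (ν * (x ^ 2 + y ^ 2))) ^ 2))
        + γ / (4 * ν) * ((x * sigmaFun (ν * (x ^ 2 + y ^ 2))) ^ 2
          + (y * sigmaFun (ν * (x ^ 2 + y ^ 2))) ^ 2)
      = γ / (4 * ν ^ 2) * (Real.exp (ν * (x ^ 2 + y ^ 2)) - 1 - ν * (x ^ 2 + y ^ 2)) := by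
  set s := ν * (x ^ 2 + y ^ 2) with hs
  have h : ν * ((x * sigmaFun s) ^ 2 + (y * sigmaFun s) ^ 2) = Real.exp s - 1 := by
    rw [← mul_sigmaFun_sq (by positivity : 0 ≤ s)]
    nth_rewrite 3 [hs]
    ring
  have h' : (x * sigmaFun s) ^ 2 + (y * sigmaFun s) ^ 2 = (Real.exp s - 1) / ν := by
    rw [← h]; field_simp
  rw [h, h', add_sub_cancel, Real.log_exp]
  field_simp
  ring

theorem abs_onsite_sub_le {ν r : ℝ} (hν : 0 < ν) (γ : ℝ) (h0 : 0 ≤ r) (h1 : ν * r ≤ 1) :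
    |γ / (4 * ν ^ 2) * (Real.exp (ν * r) - 1 - ν * r) - (γ / 8 * r ^ 2 + γ * ν / 24 * r ^ 3)|
      ≤ |γ| / 4 * ν ^ 2 * r ^ 4 := by
  have h := abs_exp_sub_cubic_le (mul_nonneg hν.le h0) h1
  have e : γ / (4 * ν ^ 2) * (Real.exp (ν * r) - 1 - ν * r)
        - (γ / 8 * r ^ 2 + γ * ν / 24 * r ^ 3)
      = γ / (4 * ν ^ 2)
        * (Real.exp (ν * r) - (1 + ν * r + (ν * r) ^ 2 / 2 + (ν * r) ^ 3 / 6)) := by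
    field_simp
    ring
  rw [e, abs_mul, abs_div, abs_of_pos (by positivity : 0 < 4 * ν ^ 2)]
  calc _ ≤ |γ| / (4 * ν ^ 2) * (ν * r) ^ 4 := by gcongr
    _ = _ := by field_simp

/-- Summation by parts turns the quintic coupling of `Z1` into a sum over bonds. -/
theorem Z1_eq (ν γ ε : ℝ) (N : ℕ) [NeZero N] (x y : ZMod N → ℝ) :
    Z1 ν γ ε N x y
      = (∑ j, (γ / 8 * ((x j) ^ 2 + (y j) ^ 2) ^ 2 + γ * ν / 24 * ((x j) ^ 2 + (y j) ^ 2) ^ 3))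
        + ε * ∑ j, (x (j + 1) * x j + y (j + 1) * y j)
          * (1 + (ν * ((x (j + 1)) ^ 2 + (y (j + 1)) ^ 2)
            + ν * ((x j) ^ 2 + (y j) ^ 2)) / 4) := by
  have hshift := Equiv.sum_comp (Equiv.addRight (1 : ZMod N))
    (fun j => ε * ν / 4 * (((x j) ^ 2 + (y j) ^ 2) * (x (j - 1) * x j + y (j - 1) * y j)))
  simp only [Equiv.coe_addRight, add_sub_cancel_right] at hshift
  have e : Z1 ν γ ε N x y
      = ∑ j, (γ / 8 * ((x j) ^ 2 + (y j) ^ 2) ^ 2 + γ * ν / 24 * ((x j) ^ 2 + (y j) ^ 2) ^ 3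
          + ε * ((x (j + 1) * x j + y (j + 1) * y j) * (1 + ν * ((x j) ^ 2 + (y j) ^ 2) / 4)))
        + ∑ j, ε * ν / 4
          * (((x j) ^ 2 + (y j) ^ 2) * (x (j - 1) * x j + y (j - 1) * y j)) := by
    rw [Z1, ← Finset.sum_add_distrib]
    refine Finset.sum_congr rfl fun j _ => ?_
    ring
  rw [e, ← hshift, Finset.mul_sum, ← Finset.sum_add_distrib, ← Finset.sum_add_distrib]
  refine Finset.sum_congr rfl fun j _ => ?_
  ring

theorem sum_abs_bond_le (N : ℕ) [NeZero N] (x y : ZMod N → ℝ) :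
    ∑ j, |x (j + 1) * x j + y (j + 1) * y j| ≤ ∑ j, ((x j) ^ 2 + (y j) ^ 2) := by
  have hshift := Equiv.sum_comp (Equiv.addRight (1 : ZMod N))
    (fun j => (x j) ^ 2 + (y j) ^ 2)
  simp only [Equiv.coe_addRight] at hshift
  calc ∑ j, |x (j + 1) * x j + y (j + 1) * y j|
      ≤ ∑ j, (((x (j + 1)) ^ 2 + (y (j + 1)) ^ 2) / 2 + ((x j) ^ 2 + (y j) ^ 2) / 2) := by
        refine Finset.sum_le_sum fun j _ => abs_le.2 ⟨?_, ?_⟩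
        · nlinarith [sq_nonneg (x (j + 1) + x j), sq_nonneg (y (j + 1) + y j)]
        · nlinarith [sq_nonneg (x (j + 1) - x j), sq_nonneg (y (j + 1) - y j)]
    _ = _ := by
        rw [Finset.sum_add_distrib, ← Finset.sum_div, ← Finset.sum_div, hshift]
        ring

/-- Cubic-quintic normal form of the Salerno model: `|H∘Φ − Z⁽¹⁾| ≤ C₁·ν²·ρ⁶·(ρ²+ε)`
on the ball of radius `ρ ≤ ρ₀`, for all `ε ∈ (0,1]`. -/
theorem stmt13 (ν γ : ℝ) (hν : 0 < ν) (N : ℕ) [NeZero N] (hN : 2 ≤ N) :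
    ∃ C₁ > (0 : ℝ), ∃ ρ₀ > (0 : ℝ), ∀ ρ : ℝ, 0 < ρ → ρ ≤ ρ₀ →
      ∀ ε : ℝ, 0 < ε → ε ≤ 1 →
        ∀ x y : ZMod N → ℝ, Real.sqrt (∑ j : ZMod N, ((x j) ^ 2 + (y j) ^ 2)) ≤ ρ →
          |salernoH ν γ ε N (Qmap ν x y) (Pmap ν x y) - Z1 ν γ ε N x y|
            ≤ C₁ * ν ^ 2 * ρ ^ 6 * (ρ ^ 2 + ε) := by
  refine ⟨|γ| / 4 + 4, by positivity, Real.sqrt (1 / ν), by positivity, ?_⟩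
  intro ρ hρ hρ₀ ε hε _ x y hxy
  have ht : ν * ρ ^ 2 ≤ 1 := by
    have h := (Real.le_sqrt hρ.le (by positivity)).1 hρ₀
    rw [le_div_iff₀ hν] at h
    linarith
  have hsum : ∑ j, ((x j) ^ 2 + (y j) ^ 2) ≤ ρ ^ 2 := (Real.sqrt_le_left hρ.le).1 hxy
  have hr0 : ∀ j, 0 ≤ (x j) ^ 2 + (y j) ^ 2 := fun j => by positivity
  have hr : ∀ j, (x j) ^ 2 + (y j) ^ 2 ≤ ρ ^ 2 := fun j =>
    (Finset.single_le_sum (f := fun j => (x j) ^ 2 + (y j) ^ 2) (fun i _ => hr0 i)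
      (Finset.mem_univ j)).trans hsum
  have hνr : ∀ j, ν * ((x j) ^ 2 + (y j) ^ 2) ≤ ν * ρ ^ 2 := fun j =>
    mul_le_mul_of_nonneg_left (hr j) hν.le
  have hνr0 : ∀ j, 0 ≤ ν * ((x j) ^ 2 + (y j) ^ 2) := fun j => mul_nonneg hν.le (hr0 j)
  have e : salernoH ν γ ε N (Qmap ν x y) (Pmap ν x y) - Z1 ν γ ε N x y
      = (∑ j, (γ / (4 * ν ^ 2) * (Real.exp (ν * ((x j) ^ 2 + (y j) ^ 2)) - 1
              - ν * ((x j) ^ 2 + (y j) ^ 2))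
            - (γ / 8 * ((x j) ^ 2 + (y j) ^ 2) ^ 2 + γ * ν / 24 * ((x j) ^ 2 + (y j) ^ 2) ^ 3)))
        + ε * ∑ j, (x (j + 1) * x j + y (j + 1) * y j)
          * (sigmaFun (ν * ((x (j + 1)) ^ 2 + (y (j + 1)) ^ 2))
              * sigmaFun (ν * ((x j) ^ 2 + (y j) ^ 2))
            - (1 + (ν * ((x (j + 1)) ^ 2 + (y (j + 1)) ^ 2)
              + ν * ((x j) ^ 2 + (y j) ^ 2)) / 4)) := by
    have hc : ∑ j, (Qmap ν x y (j + 1) * Qmap ν x y j + Pmap ν x y (j + 1) * Pmap ν x y j)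
        = ∑ j, (x (j + 1) * x j + y (j + 1) * y j)
          * (sigmaFun (ν * ((x (j + 1)) ^ 2 + (y (j + 1)) ^ 2))
              * sigmaFun (ν * ((x j) ^ 2 + (y j) ^ 2))) := by
      refine Finset.sum_congr rfl fun j _ => ?_
      simp only [Qmap, Pmap]
      ring
    rw [Z1_eq, salernoH, hc]
    simp only [Qmap, Pmap, onsite_transformed_eq hν]
    simp only [mul_sub _ (sigmaFun _ * sigmaFun _), Finset.sum_sub_distrib]
    ring
  have h1 : |∑ j, (γ / (4 * ν ^ 2) * (Real.exp (ν * ((x j) ^ 2 + (y j) ^ 2)) - 1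
              - ν * ((x j) ^ 2 + (y j) ^ 2))
            - (γ / 8 * ((x j) ^ 2 + (y j) ^ 2) ^ 2 + γ * ν / 24 * ((x j) ^ 2 + (y j) ^ 2) ^ 3))|
      ≤ |γ| / 4 * ν ^ 2 * ρ ^ 8 := by
    calc _ ≤ ∑ j, |γ| / 4 * ν ^ 2 * (ρ ^ 2) ^ 3 * ((x j) ^ 2 + (y j) ^ 2) := by
          refine (Finset.abs_sum_le_sum_abs _ _).trans (Finset.sum_le_sum fun j _ => ?_)
          refine (abs_onsite_sub_le hν γ (hr0 j) ((hνr j).trans ht)).trans ?_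
          rw [pow_succ ((x j) ^ 2 + (y j) ^ 2) 3, ← mul_assoc]
          gcongr
          exact hr j
      _ = |γ| / 4 * ν ^ 2 * (ρ ^ 2) ^ 3 * ∑ j, ((x j) ^ 2 + (y j) ^ 2) := by
          rw [Finset.mul_sum]
      _ ≤ |γ| / 4 * ν ^ 2 * (ρ ^ 2) ^ 3 * ρ ^ 2 := by gcongr
      _ = _ := by ring
  have h2 : |∑ j, (x (j + 1) * x j + y (j + 1) * y j)
          * (sigmaFun (ν * ((x (j + 1)) ^ 2 + (y (j + 1)) ^ 2))
              * sigmaFun (ν * ((x j) ^ 2 + (y j) ^ 2))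
            - (1 + (ν * ((x (j + 1)) ^ 2 + (y (j + 1)) ^ 2)
              + ν * ((x j) ^ 2 + (y j) ^ 2)) / 4))| ≤ 4 * ν ^ 2 * ρ ^ 6 := by
    calc _ ≤ ∑ j, |x (j + 1) * x j + y (j + 1) * y j| * (4 * (ν * ρ ^ 2) ^ 2) := by
          refine (Finset.abs_sum_le_sum_abs _ _).trans (Finset.sum_le_sum fun j _ => ?_)
          rw [abs_mul]
          gcongr
          exact abs_sigmaFun_mul_sub_le (hνr0 _) (hνr0 _) (hνr _) (hνr _) ht
      _ = (∑ j, |x (j + 1) * x j + y (j + 1) * y j|) * (4 * (ν * ρ ^ 2) ^ 2) := by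
          rw [Finset.sum_mul]
      _ ≤ ρ ^ 2 * (4 * (ν * ρ ^ 2) ^ 2) := by
          gcongr
          exact (sum_abs_bond_le N x y).trans hsum
      _ = _ := by ring
  rw [e]
  refine (abs_add_le _ _).trans ?_
  rw [abs_mul, abs_of_pos hε]
  calc _ ≤ |γ| / 4 * ν ^ 2 * ρ ^ 8 + ε * (4 * ν ^ 2 * ρ ^ 6) := by gcongr
    _ ≤ |γ| / 4 * ν ^ 2 * ρ ^ 8 + ε * (4 * ν ^ 2 * ρ ^ 6)
        + (4 * ν ^ 2 * ρ ^ 8 + ε * (|γ| / 4 * ν ^ 2 * ρ ^ 6)) :=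
        le_add_of_nonneg_right (by positivity)
    _ = _ := by ring
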